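/- Let λ₁ ≥ ⋯ ≥ λₙ > 0 and x ∈ ℝⁿ, x ≠ 0. Then the one-step shrinking factor satisfies ρ(x,λ) ≤ (λ₁−λₙ)/(λ₁+λₙ), and equality holds if and only if both: (i) for every i with x_i ≠ 0, λ_i ∈ {λ₁, λₙ}; and (ii) Σ_{i: λ_i = λ₁} λ_i² x_i² = Σ_{i: λ_i = λₙ} λ_i² x_i². -/

import Mathlib

open MeasureTheory Filter Finset Real Metric

noncomputable section

/-- `qform lam k x = xᵀ Aᵏ x` for `A = diag lam`. -/
def qform {n : ℕ} (lam : Fin n → ℝ) (k : ℕ) (x : Fin n → ℝ) : ℝ :=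
  ∑ i, lam i ^ k * x i ^ 2

/-- Exact line search gradient descent map for `f(x) = ½ xᵀAx`, `A = diag lam`;
`GD 0 = 0`. -/
def GD {n : ℕ} (lam : Fin n → ℝ) (x : Fin n → ℝ) : Fin n → ℝ :=
  if x = 0 then 0 else fun i => x i - qform lam 2 x / qform lam 3 x * (lam i * x i)

/-- One-step shrinking factor `ρ(x, λ)`, with the convention `ρ(0, λ) = 0`. -/
def shrink {n : ℕ} (lam : Fin n → ℝ) (x : Fin n → ℝ) : ℝ :=
  if x = 0 then 0 else
    Real.sqrt (1 - (qform lam 2 x) ^ 2 / (qform lam 1 x * qform lam 3 x))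

/-- Rate of convergence `ρ*(x⁰, λ)` of exact line search gradient descent from seed `x⁰`. -/
def rocGD {n : ℕ} (lam : Fin n → ℝ) (x0 : Fin n → ℝ) : ℝ :=
  Filter.limsup
    (fun k : ℕ => (∏ j ∈ Finset.range k, shrink lam ((GD lam)^[j] x0)) ^ ((k : ℝ)⁻¹))
    Filter.atTop

/-- The weighted sum of the products `(M - λᵢ) (λᵢ - m)` in terms of the forms `xᵀAᵏx`. -/
lemma qform_defect_eq {n : ℕ} (lam x : Fin n → ℝ) (M m : ℝ) :
    (M + m) * qform lam 2 x - qform lam 3 x - M * m * qform lam 1 x =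
      ∑ i, (M - lam i) * (lam i - m) * (lam i * x i ^ 2) := by
  simp only [qform, Finset.mul_sum, ← Finset.sum_sub_distrib]
  exact Finset.sum_congr rfl fun i _ => by ring

lemma qform_pos {n : ℕ} {lam x : Fin n → ℝ} (hlam : ∀ i, 0 < lam i) (hx : x ≠ 0) (k : ℕ) :
    0 < qform lam k x := by
  obtain ⟨i, hi⟩ := Function.ne_iff.mp hx
  exact Finset.sum_pos' (fun j _ => mul_nonneg (pow_pos (hlam j) k).le (sq_nonneg _))
    ⟨i, Finset.mem_univ i, mul_pos (pow_pos (hlam i) k) (sq_pos_of_ne_zero hi)⟩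

lemma qform_two_sq_le {n : ℕ} {lam : Fin n → ℝ} (hlam : ∀ i, 0 < lam i) (x : Fin n → ℝ) :
    qform lam 2 x ^ 2 ≤ qform lam 1 x * qform lam 3 x :=
  Finset.sum_sq_le_sum_mul_sum_of_sq_le_mul _
    (fun i _ => mul_nonneg (pow_pos (hlam i) 1).le (sq_nonneg _))
    (fun i _ => mul_nonneg (pow_pos (hlam i) 3).le (sq_nonneg _)) fun i _ => le_of_eq (by ring)

open scoped Classical in
/-- When the active eigenvalues are `M` or `m`, the difference `xᵀA³x - M m xᵀAx` measures the
imbalance between the weights of the two eigenspaces. -/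
lemma qform_three_sub_eq {n : ℕ} {lam x : Fin n → ℝ} {M m : ℝ}
    (h : ∀ i, x i ≠ 0 → lam i = M ∨ lam i = m) :
    qform lam 3 x - M * m * qform lam 1 x =
      (M - m) * (∑ i ∈ Finset.univ.filter (fun i => lam i = M), lam i ^ 2 * x i ^ 2 -
        ∑ i ∈ Finset.univ.filter (fun i => lam i = m), lam i ^ 2 * x i ^ 2) := by
  simp only [qform, Finset.sum_filter, ← Finset.sum_sub_distrib, Finset.mul_sum]
  refine Finset.sum_congr rfl fun i _ => ?_
  by_cases hxi : x i = 0
  · simp [hxi]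
  · by_cases hMm : M = m
    · have hi : lam i = m := by simpa [hMm] using h i hxi
      rw [hMm, hi]
      ring
    · rcases h i hxi with hi | hi
      · rw [hi, if_pos rfl, if_neg hMm]
        ring
      · rw [hi, if_neg (Ne.symm hMm), if_pos rfl]
        ring

open scoped Classical in
/-- Kantorovich bound for any positive interval `[m, M]` containing the eigenvalues. -/
lemma shrink_le_and_eq_iff_of_mem_Icc {n : ℕ} {lam x : Fin n → ℝ} {M m : ℝ} (hm : 0 < m)
    (hmM : m ≤ M) (hlam : ∀ i, lam i ∈ Set.Icc m M) (hx : x ≠ 0) :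
    shrink lam x ≤ (M - m) / (M + m) ∧
    (shrink lam x = (M - m) / (M + m) ↔
      (∀ i, x i ≠ 0 → lam i = M ∨ lam i = m) ∧
        ∑ i ∈ Finset.univ.filter (fun i => lam i = M), lam i ^ 2 * x i ^ 2 =
          ∑ i ∈ Finset.univ.filter (fun i => lam i = m), lam i ^ 2 * x i ^ 2) := by
  have hpos : ∀ i, 0 < lam i := fun i => hm.trans_le (hlam i).1
  have h1 := qform_pos hpos hx 1
  have h3 := qform_pos hpos hx 3
  have hcs := qform_two_sq_le hpos x
  have hdef := qform_defect_eq lam x M m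
  have hterm : ∀ i ∈ Finset.univ, 0 ≤ (M - lam i) * (lam i - m) * (lam i * x i ^ 2) :=
    fun i _ => mul_nonneg (mul_nonneg (sub_nonneg.2 (hlam i).2) (sub_nonneg.2 (hlam i).1))
      (mul_nonneg (hpos i).le (sq_nonneg _))
  have hD : 0 ≤ (M + m) * qform lam 2 x - qform lam 3 x - M * m * qform lam 1 x :=
    hdef ▸ Finset.sum_nonneg hterm
  have hD0 : (M + m) * qform lam 2 x - qform lam 3 x - M * m * qform lam 1 x = 0 ↔
      ∀ i, x i ≠ 0 → lam i = M ∨ lam i = m := by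
    rw [hdef, Finset.sum_eq_zero_iff_of_nonneg hterm]
    refine forall_congr' fun i => ?_
    simp only [Finset.mem_univ, true_imp_iff, mul_eq_zero, sub_eq_zero, (hpos i).ne', false_or,
      pow_eq_zero_iff two_ne_zero, @eq_comm _ M]
    tauto
  have hbal := @qform_three_sub_eq n lam x M m
  rw [shrink, if_neg hx]
  set a := qform lam 1 x
  set b := qform lam 2 x
  set c := qform lam 3 x
  have hM : 0 < M := hm.trans_le hmM
  have hr : 0 ≤ (M - m) / (M + m) := div_nonneg (sub_nonneg.2 hmM) (add_pos hM hm).le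
  have hac : 0 < a * c := mul_pos h1 h3
  have hE : 0 ≤ c + M * m * a := by positivity
  have ht : 0 ≤ 1 - b ^ 2 / (a * c) := sub_nonneg.2 ((div_le_one hac).2 hcs)
  have hgap : ((M - m) / (M + m)) ^ 2 - (1 - b ^ 2 / (a * c)) =
      (((M + m) * b - c - M * m * a) * ((M + m) * b + (c + M * m * a)) +
        (c - M * m * a) ^ 2) / ((M + m) ^ 2 * (a * c)) := by
    have := (add_pos hM hm).ne'
    field_simp
    ring
  have hden : 0 < (M + m) ^ 2 * (a * c) := by positivity
  have hb : 0 < (M + m) * b + (c + M * m * a) := by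
    have : 0 < M * m * a := by positivity
    linarith
  have hprod := mul_nonneg hD hb.le
  constructor
  · rw [Real.sqrt_le_left hr, ← sub_nonneg, hgap]
    exact div_nonneg (add_nonneg hprod (sq_nonneg _)) hden.le
  · rw [Real.sqrt_eq_iff_eq_sq ht hr, eq_comm, ← sub_eq_zero, hgap, div_eq_zero_iff,
      or_iff_left hden.ne', add_eq_zero_iff_of_nonneg hprod (sq_nonneg _), mul_eq_zero,
      or_iff_left hb.ne', hD0, pow_eq_zero_iff two_ne_zero]
    refine and_congr_right fun h => ?_
    rw [hbal h, mul_eq_zero, sub_eq_zero, sub_eq_zero, or_iff_right_of_imp]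
    rintro rfl
    rfl

open scoped Classical in
/-- sharp Kantorovich bound: `ρ(x,λ) ≤ (λ₁−λₙ)/(λ₁+λₙ)`, with equality iff
(i) every active coordinate has extremal eigenvalue, and
(ii) the weights `λᵢ²xᵢ²` balance between the two extremal eigenvalues. -/
theorem shrink_le_and_eq_iff (n : ℕ) (hn : 1 ≤ n) (lam : Fin n → ℝ)
    (hord : ∀ i j : Fin n, i ≤ j → lam j ≤ lam i)
    (hpos : 0 < lam ⟨n - 1, by omega⟩)
    (x : Fin n → ℝ) (hx : x ≠ 0) :
    shrink lam x ≤
      (lam ⟨0, by omega⟩ - lam ⟨n - 1, by omega⟩) /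
        (lam ⟨0, by omega⟩ + lam ⟨n - 1, by omega⟩) ∧
    (shrink lam x =
        (lam ⟨0, by omega⟩ - lam ⟨n - 1, by omega⟩) /
          (lam ⟨0, by omega⟩ + lam ⟨n - 1, by omega⟩) ↔
      ((∀ i : Fin n, x i ≠ 0 →
          lam i = lam ⟨0, by omega⟩ ∨ lam i = lam ⟨n - 1, by omega⟩) ∧
        ∑ i ∈ Finset.univ.filter (fun i => lam i = lam ⟨0, by omega⟩),
            lam i ^ 2 * x i ^ 2 =
          ∑ i ∈ Finset.univ.filter (fun i => lam i = lam ⟨n - 1, by omega⟩),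
            lam i ^ 2 * x i ^ 2)) := by
  refine shrink_le_and_eq_iff_of_mem_Icc hpos (hord _ _ (Fin.mk_le_mk.2 (Nat.zero_le _)))
    (fun i => ⟨hord _ _ (Fin.le_def.2 (Nat.le_sub_one_of_lt i.2)),
      hord _ _ (Fin.le_def.2 (Nat.zero_le _))⟩) hx

end
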